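/- Consider the linear penalty Σ_{i=1}^n p_i·l_i, and let L = ⌈(n−1)/(D−1)⌉ (the trivial maximum length). Let l_ub be an integer with l_min < l_ub < L and n ≤ D^{l_ub}. If a length vector minimizing Σ_{i=1}^n p_i·l_i among feasible length vectors with entries in [l_min, L] has some entry strictly greater than l_ub, then there exists a length vector minimizing Σ_{i=1}^n p_i·l_i among feasible length vectors with entries in [l_min, l_ub] whose maximum entry equals l_ub. -/

import Mathlib

/-- The Kraft sum `κ(l) = Σ_{i=1}^n D^{−l_i}` of a length vector. -/
noncomputable def kraft (D n : ℕ) (l : ℕ → ℕ) : ℝ :=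
  ∑ i ∈ Finset.Icc 1 n, (D : ℝ) ^ (-(l i : ℤ))

/-- The linear penalty `Σ_{i=1}^n p_i·l_i` of a length vector. -/
noncomputable def linPenalty (n : ℕ) (p : ℕ → ℝ) (l : ℕ → ℕ) : ℝ :=
  ∑ i ∈ Finset.Icc 1 n, p i * (l i : ℝ)

lemma sum_comp_update {R : Type*} [AddCommMonoid R] {s : Finset ℕ} {i : ℕ} (hi : i ∈ s)
    (f : ℕ → ℕ → R) (c : ℕ → ℕ) (v : ℕ) :
    ∑ j ∈ s, f j (Function.update c i v j) + f i (c i) = ∑ j ∈ s, f j (c j) + f i v := by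
  rw [← Finset.add_sum_erase s _ hi, ← Finset.add_sum_erase s (fun j => f j (c j)) hi]
  have h : ∑ j ∈ s.erase i, f j (Function.update c i v j) = ∑ j ∈ s.erase i, f j (c j) :=
    Finset.sum_congr rfl fun j hj => by rw [Function.update_of_ne (Finset.ne_of_mem_erase hj)]
  rw [h, Function.update_self]
  abel

lemma pow_sub_succ_eq {D T h : ℕ} (hD : 2 ≤ D) (h0 : 0 < h) (hT : h ≤ T) :
    D ^ (T - (h - 1)) = D ^ (T - h) + (D - 1) * D ^ (T - h) := by
  obtain ⟨d, rfl⟩ : ∃ d, D = d + 1 := ⟨D - 1, by omega⟩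
  rw [show T - (h - 1) = T - h + 1 by omega, pow_succ, Nat.add_sub_cancel]
  ring

lemma sub_one_mul_pow_dvd {D T a c h : ℕ} (hD : 2 ≤ D) (hac : a ≤ c) (hch : c ≤ h) (hT : c ≤ T) :
    (((D - 1) * D ^ (T - h) : ℕ) : ℤ) ∣ (D : ℤ) ^ (T - a) - (D : ℤ) ^ (T - c) := by
  have h1 : (D : ℤ) ^ (T - a) - (D : ℤ) ^ (T - c) = ((D : ℤ) ^ (c - a) - 1) * (D : ℤ) ^ (T - c) := by
    rw [show T - a = (c - a) + (T - c) by omega, pow_add]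
    ring
  rw [h1]
  push_cast [Nat.cast_sub (show 1 ≤ D by omega)]
  exact mul_dvd_mul (by simpa using sub_dvd_pow_sub_pow (D : ℤ) 1 (c - a))
    (pow_dvd_pow _ (by omega))

/-- Discrete intermediate value property of scaled Kraft sums between two length vectors. -/
lemma exists_between_sum_pow_eq {D T K X q : ℕ} (hD : 2 ≤ D) (s : Finset ℕ) (a : ℕ → ℕ)
    (hKT : K ≤ T) (hX : X + q * ((D - 1) * D ^ (T - K)) = ∑ i ∈ s, D ^ (T - a i)) (c : ℕ → ℕ)
    (hac : ∀ i ∈ s, a i ≤ c i) (hcT : ∀ i ∈ s, c i ≤ T) (hK : ∀ i ∈ s, a i < c i → K ≤ a i)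
    (hcX : ∑ i ∈ s, D ^ (T - c i) ≤ X) :
    ∃ c' : ℕ → ℕ, (∀ i ∈ s, a i ≤ c' i ∧ c' i ≤ c i) ∧ ∑ i ∈ s, D ^ (T - c' i) = X := by
  induction hs : ∑ i ∈ s, c i using Nat.strong_induction_on generalizing c with
  | _ N ih =>
  by_cases hEq : ∑ i ∈ s, D ^ (T - c i) = X
  · exact ⟨c, fun i hi => ⟨hac i hi, le_rfl⟩, hEq⟩
  have hne : (s.filter fun i => a i < c i).Nonempty := by
    by_contra hcon
    rw [Finset.not_nonempty_iff_eq_empty, Finset.filter_eq_empty_iff] at hcon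
    have : ∑ i ∈ s, D ^ (T - c i) = ∑ i ∈ s, D ^ (T - a i) :=
      Finset.sum_congr rfl fun i hi => by
        rw [show c i = a i from le_antisymm (not_lt.1 (hcon hi)) (hac i hi)]
    omega
  obtain ⟨i, hi, hmax⟩ := Finset.exists_max_image _ c hne
  rw [Finset.mem_filter] at hi
  obtain ⟨his, hai⟩ := hi
  have hKi := hK i his hai
  have hTi := hcT i his
  have hdvd : (((D - 1) * D ^ (T - c i) : ℕ) : ℤ) ∣
      ∑ j ∈ s, ((D : ℤ) ^ (T - a j) - (D : ℤ) ^ (T - c j)) := by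
    refine Finset.dvd_sum fun j hj => ?_
    rcases (hac j hj).lt_or_eq with hlt | heq
    · exact sub_one_mul_pow_dvd hD hlt.le (hmax j (Finset.mem_filter.2 ⟨hj, hlt⟩)) (hcT j hj)
    · rw [heq, sub_self]
      exact dvd_zero _
  have hdvd' : (((D - 1) * D ^ (T - c i) : ℕ) : ℤ) ∣ ((q * ((D - 1) * D ^ (T - K)) : ℕ) : ℤ) :=
    Int.natCast_dvd_natCast.2 (Dvd.dvd.mul_left
      (mul_dvd_mul_left _ (pow_dvd_pow _ (by omega))) _)
  have hle : ∑ j ∈ s, D ^ (T - c j) + (D - 1) * D ^ (T - c i) ≤ X := by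
    have h3 := dvd_sub hdvd hdvd'
    have h4 : ∑ j ∈ s, ((D : ℤ) ^ (T - a j) - (D : ℤ) ^ (T - c j))
        - ((q * ((D - 1) * D ^ (T - K)) : ℕ) : ℤ)
        = (X : ℤ) - ((∑ j ∈ s, D ^ (T - c j) : ℕ) : ℤ) := by
      rw [Finset.sum_sub_distrib]
      have := congrArg (Nat.cast : ℕ → ℤ) hX
      push_cast at this ⊢
      linarith
    rw [h4] at h3
    have := Int.le_of_dvd (by omega) h3
    omega
  have hupd := sum_comp_update his (fun _ x => D ^ (T - x)) c (c i - 1)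
  have hupd' := sum_comp_update his (fun _ x => x) c (c i - 1)
  have hp := pow_sub_succ_eq hD (show 0 < c i by omega) hTi
  have hval : ∀ j, Function.update c i (c i - 1) j = if j = i then c i - 1 else c j :=
    fun j => Function.update_apply ..
  obtain ⟨c', hc', hsum⟩ := ih _ (by omega) (Function.update c i (c i - 1))
    (fun j hj => by
      rw [hval]; split_ifs with h
      · subst h; omega
      · exact hac j hj)
    (fun j hj => by
      rw [hval]; split_ifs with h
      · omega
      · exact hcT j hj)
    (fun j hj => by
      rw [hval]; split_ifs with h
      · subst h; intro; exact hKi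
      · exact hK j hj)
    (by omega) rfl
  refine ⟨c', fun j hj => ⟨(hc' j hj).1, (hc' j hj).2.trans ?_⟩, hsum⟩
  rw [hval]; split_ifs with h
  · subst h; omega
  · exact le_rfl

lemma kraft_eq_sum_inv_pow (D n : ℕ) (l : ℕ → ℕ) :
    kraft D n l = ∑ i ∈ Finset.Icc 1 n, ((D : ℝ)⁻¹) ^ l i := by
  simp [kraft, zpow_neg, inv_pow]

lemma kraft_mul_pow {D n T : ℕ} (hD : 2 ≤ D) {l : ℕ → ℕ} (hl : ∀ i ∈ Finset.Icc 1 n, l i ≤ T) :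
    kraft D n l * (D : ℝ) ^ T = ((∑ i ∈ Finset.Icc 1 n, D ^ (T - l i) : ℕ) : ℝ) := by
  have hD0 : (D : ℝ) ≠ 0 := by positivity
  rw [kraft_eq_sum_inv_pow, Finset.sum_mul]
  push_cast
  refine Finset.sum_congr rfl fun i hi => ?_
  rw [inv_pow, pow_sub₀ _ hD0 (hl i hi), mul_comm]

lemma kraft_le_one_iff {D n T : ℕ} (hD : 2 ≤ D) {l : ℕ → ℕ}
    (hl : ∀ i ∈ Finset.Icc 1 n, l i ≤ T) :
    kraft D n l ≤ 1 ↔ ∑ i ∈ Finset.Icc 1 n, D ^ (T - l i) ≤ D ^ T := by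
  have hD0 : (0 : ℝ) < (D : ℝ) ^ T := by positivity
  rw [← mul_le_mul_iff_left₀ hD0, kraft_mul_pow hD hl, one_mul]
  exact_mod_cast Iff.rfl

lemma kraft_eq_one_iff {D n T : ℕ} (hD : 2 ≤ D) {l : ℕ → ℕ}
    (hl : ∀ i ∈ Finset.Icc 1 n, l i ≤ T) :
    kraft D n l = 1 ↔ ∑ i ∈ Finset.Icc 1 n, D ^ (T - l i) = D ^ T := by
  have hD0 : (D : ℝ) ^ T ≠ 0 := by positivity
  rw [← mul_left_inj' hD0, kraft_mul_pow hD hl, one_mul]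
  exact_mod_cast Iff.rfl

lemma linPenalty_update {n i : ℕ} (hi : i ∈ Finset.Icc 1 n) (p : ℕ → ℝ) (c : ℕ → ℕ) (v : ℕ) :
    linPenalty n p (Function.update c i v) + p i * (c i : ℝ) = linPenalty n p c + p i * (v : ℝ) :=
  sum_comp_update hi (fun j x => p j * (x : ℝ)) c v

lemma exists_lt_of_kraft_le_one {D lmin n : ℕ} (hD : 2 ≤ D) (hn1 : D ^ lmin < n) {f : ℕ → ℕ}
    (hf : kraft D n f ≤ 1) : ∃ i ∈ Finset.Icc 1 n, lmin < f i := by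
  by_contra! hcon
  rw [kraft_le_one_iff hD hcon] at hf
  have : ∑ i ∈ Finset.Icc 1 n, 1 ≤ ∑ i ∈ Finset.Icc 1 n, D ^ (lmin - f i) :=
    Finset.sum_le_sum fun i _ => Nat.one_le_pow _ _ (by omega)
  simp at this
  omega

/-- An optimal length vector satisfies Kraft's inequality with equality. -/
lemma kraft_eq_one_of_optimal {D lmin n b : ℕ} (hD : 2 ≤ D) (hn1 : D ^ lmin < n)
    (hmod : (D - 1) ∣ (n - 1)) {p : ℕ → ℝ} (hppos : ∀ i ∈ Finset.Icc 1 n, 0 < p i) {f : ℕ → ℕ}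
    (hfb : ∀ i ∈ Finset.Icc 1 n, lmin ≤ f i ∧ f i ≤ b) (hf : kraft D n f ≤ 1)
    (hopt : ∀ g : ℕ → ℕ, (∀ i ∈ Finset.Icc 1 n, lmin ≤ g i ∧ g i ≤ b) →
      kraft D n g ≤ 1 → linPenalty n p f ≤ linPenalty n p g) :
    kraft D n f = 1 := by
  obtain ⟨i₁, hi₁, hlt⟩ := exists_lt_of_kraft_le_one hD hn1 hf
  obtain ⟨i, hi, hmax⟩ := Finset.exists_max_image (Finset.Icc 1 n) f ⟨i₁, hi₁⟩
  have hfi : lmin < f i := hlt.trans_le (hmax i₁ hi₁)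
  rw [kraft_eq_one_iff hD hmax]
  rw [kraft_le_one_iff hD hmax] at hf
  have hval : ∀ j, Function.update f i (f i - 1) j = if j = i then f i - 1 else f j :=
    fun j => Function.update_apply ..
  have hupd := sum_comp_update hi (fun _ x => D ^ (f i - x)) f (f i - 1)
  have hp := pow_sub_succ_eq hD (show 0 < f i by omega) le_rfl
  simp only [Nat.sub_self, pow_zero, mul_one] at hupd hp
  have hbig : D ^ f i < ∑ j ∈ Finset.Icc 1 n, D ^ (f i - f j) + (D - 1) := by
    by_contra! hcon
    have hpen := hopt (Function.update f i (f i - 1))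
      (fun j hj => by
        have := hfb j hj
        have := hfb i hi
        rw [hval]; split_ifs <;> omega)
      ((kraft_le_one_iff (T := f i) hD fun j hj => by
        have := hmax j hj
        rw [hval]; split_ifs <;> omega).2 (by omega))
    have h1 := linPenalty_update hi p f (f i - 1)
    have h2 := hppos i hi
    have h3 : ((f i - 1 : ℕ) : ℝ) = (f i : ℝ) - 1 := by
      rw [Nat.cast_sub (by omega)]; simp
    rw [h3] at h1
    nlinarith
  have hdvd : ((D - 1 : ℕ) : ℤ) ∣ (D : ℤ) ^ f i - ∑ j ∈ Finset.Icc 1 n, (D : ℤ) ^ (f i - f j) := by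
    have hpow : ∀ e : ℕ, ((D - 1 : ℕ) : ℤ) ∣ (D : ℤ) ^ e - 1 := fun e => by
      push_cast [Nat.cast_sub (show 1 ≤ D by omega)]
      simpa using sub_dvd_pow_sub_pow (D : ℤ) 1 e
    have h1 : ((D - 1 : ℕ) : ℤ) ∣ ∑ j ∈ Finset.Icc 1 n, ((D : ℤ) ^ (f i - f j) - 1) :=
      Finset.dvd_sum fun j _ => hpow _
    have h2 : ((D - 1 : ℕ) : ℤ) ∣ ((n - 1 : ℕ) : ℤ) := Int.natCast_dvd_natCast.2 hmod
    have h3 := dvd_sub (dvd_sub (hpow (f i)) h1) h2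
    rw [Finset.sum_sub_distrib, Nat.cast_sub (show 1 ≤ n by omega)] at h3
    simp only [Finset.sum_const, Nat.card_Icc, Nat.add_sub_cancel, nsmul_eq_mul, mul_one,
      Nat.cast_one] at h3
    rwa [show ∀ x y z : ℤ, x - 1 - (y - z) - (z - 1) = x - y from fun _ _ _ => by ring] at h3
  have hz : ((D ^ f i - ∑ j ∈ Finset.Icc 1 n, D ^ (f i - f j) : ℕ) : ℤ)
      = (D : ℤ) ^ f i - ∑ j ∈ Finset.Icc 1 n, (D : ℤ) ^ (f i - f j) := by
    rw [Nat.cast_sub hf]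
    push_cast
    rfl
  rw [← hz] at hdvd
  have := Nat.eq_zero_of_dvd_of_lt (Int.natCast_dvd_natCast.1 hdvd) (by omega)
  omega

lemma exists_optimal {D lmin n b : ℕ} (hD : 2 ≤ D) (hb : lmin ≤ b) (hn : n ≤ D ^ b) (p : ℕ → ℝ) :
    ∃ m : ℕ → ℕ, (∀ i ∈ Finset.Icc 1 n, lmin ≤ m i ∧ m i ≤ b) ∧ kraft D n m ≤ 1 ∧
      ∀ g : ℕ → ℕ, (∀ i ∈ Finset.Icc 1 n, lmin ≤ g i ∧ g i ≤ b) →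
        kraft D n g ≤ 1 → linPenalty n p m ≤ linPenalty n p g := by
  let F : (Fin (n + 1) → Fin (b + 1)) → ℕ → ℕ := fun f i =>
    if h : i < n + 1 then (f ⟨i, h⟩ : ℕ) else 0
  let S : Set (Fin (n + 1) → Fin (b + 1)) :=
    {f | (∀ i ∈ Finset.Icc 1 n, lmin ≤ F f i ∧ F f i ≤ b) ∧ kraft D n (F f) ≤ 1}
  have key : ∀ g : ℕ → ℕ, (∀ i ∈ Finset.Icc 1 n, lmin ≤ g i ∧ g i ≤ b) →
      kraft D n g ≤ 1 → ∃ f ∈ S, linPenalty n p (F f) = linPenalty n p g := by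
    intro g hg hk
    let f : Fin (n + 1) → Fin (b + 1) := fun i => ⟨min (g i) b, by omega⟩
    have hfg : ∀ i ∈ Finset.Icc 1 n, F f i = g i := by
      intro i hi
      have h1 := hg i hi
      rw [Finset.mem_Icc] at hi
      simp only [F, f, dif_pos (show i < n + 1 by omega)]
      omega
    refine ⟨f, ⟨fun i hi => by rw [hfg i hi]; exact hg i hi, ?_⟩, ?_⟩
    · convert hk using 1
      exact Finset.sum_congr rfl fun i hi => by rw [hfg i hi]
    · exact Finset.sum_congr rfl fun i hi => by rw [hfg i hi]
  obtain ⟨f₀, hf₀, -⟩ := key (fun _ => b) (fun _ _ => ⟨hb, le_rfl⟩)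
    ((kraft_le_one_iff (T := b) hD fun _ _ => le_rfl).2 (by simpa using hn))
  obtain ⟨f, hf, hmin⟩ := Set.exists_min_image S (fun f => linPenalty n p (F f))
    (Set.toFinite S) ⟨f₀, hf₀⟩
  refine ⟨F f, hf.1, hf.2, fun g hg hk => ?_⟩
  obtain ⟨f', hf', he⟩ := key g hg hk
  exact he ▸ hmin f' hf'

/-- The exchange step: `l` is compared with `m` shifted by `r`, where `k` is the largest entry of
`m` at which `l < m + r`. The vector `c` absorbs one unit of Kraft weight `(D-1) D^{-(k+r)}`,
partly taken from the entry `j₀`. -/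
lemma exists_exchange {D n N r k j₀ : ℕ} (hD : 2 ≤ D) {l m : ℕ → ℕ}
    (hlN : ∀ i ∈ Finset.Icc 1 n, l i ≤ N) (hmN : ∀ i ∈ Finset.Icc 1 n, m i + r < N)
    (hl1 : kraft D n l = 1) (hm1 : kraft D n m = 1) (hkN : k + r < N)
    (hk : ∀ i ∈ Finset.Icc 1 n, k < m i → m i + r ≤ l i)
    (hj₀ : j₀ ∈ Finset.Icc 1 n) (hlj₀ : l j₀ = N) :
    ∃ c : ℕ → ℕ, (∀ i ∈ Finset.Icc 1 n, min (l i) (max (m i) k + r) ≤ c i ∧ c i ≤ l i) ∧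
      c j₀ < N ∧ kraft D n c = 1 + ((D : ℝ) - 1) * ((D : ℝ)⁻¹) ^ (k + r) := by
  set s := Finset.Icc 1 n with hs
  set a : ℕ → ℕ := fun i => min (l i) (max (m i) k + r) with ha
  have hal : ∀ i ∈ s, a i ≤ l i := fun i _ => min_le_left _ _
  have hlsum := (kraft_eq_one_iff hD hlN).1 hl1
  have hmsum : ∑ i ∈ s, D ^ (N - r - m i) = D ^ (N - r) :=
    (kraft_eq_one_iff hD fun i hi => by have := hmN i hi; omega).1 hm1
  have hdl : ((D : ℤ) ^ (N - (k + r))) ∣ ∑ i ∈ s, (D : ℤ) ^ (N - l i) := by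
    have : ∑ i ∈ s, (D : ℤ) ^ (N - l i) = (D : ℤ) ^ N := by exact_mod_cast hlsum
    rw [this]
    exact pow_dvd_pow _ (by omega)
  have hdm : ((D : ℤ) ^ (N - (k + r))) ∣ ∑ i ∈ s, (D : ℤ) ^ (N - r - m i) := by
    have : ∑ i ∈ s, (D : ℤ) ^ (N - r - m i) = (D : ℤ) ^ (N - r) := by exact_mod_cast hmsum
    rw [this]
    exact pow_dvd_pow _ (by omega)
  have hdam : ((D : ℤ) ^ (N - (k + r))) ∣
      ∑ i ∈ s, ((D : ℤ) ^ (N - a i) - (D : ℤ) ^ (N - r - m i)) := by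
    refine Finset.dvd_sum fun i hi => ?_
    have h1 := hk i hi
    by_cases hmk : k < m i
    · have : N - a i = N - r - m i := by simp only [ha]; have := h1 hmk; omega
      rw [this, sub_self]
      exact dvd_zero _
    · exact dvd_sub (pow_dvd_pow _ (by simp only [ha]; omega)) (pow_dvd_pow _ (by omega))
  have hd1 : ((D : ℤ) ^ (N - (k + r))) ∣ ∑ i ∈ s, ((D : ℤ) ^ (N - a i) - (D : ℤ) ^ (N - l i)) := by
    have := dvd_sub (dvd_add hdam hdm) hdl
    simpa [Finset.sum_sub_distrib] using this
  have hd2 : ((D : ℤ) - 1) ∣ ∑ i ∈ s, ((D : ℤ) ^ (N - a i) - (D : ℤ) ^ (N - l i)) := by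
    refine Finset.dvd_sum fun i hi => ?_
    have := sub_one_mul_pow_dvd (T := N) hD (hal i hi) (hlN i hi) (hlN i hi)
    push_cast [Nat.cast_sub (show 1 ≤ D by omega)] at this
    exact (Dvd.intro _ rfl).trans this
  have hcop : IsCoprime ((D : ℤ) - 1) ((D : ℤ) ^ (N - (k + r))) :=
    IsCoprime.pow_right ⟨-1, 1, by ring⟩
  obtain ⟨q, hq⟩ := hcop.mul_dvd hd2 hd1
  have hD2 : (2 : ℤ) ≤ D := by exact_mod_cast hD
  have hsum_lt : ∑ i ∈ s, D ^ (N - l i) < ∑ i ∈ s, D ^ (N - a i) := by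
    refine Finset.sum_lt_sum (fun i hi => Nat.pow_le_pow_right (by omega) ?_) ⟨j₀, hj₀, ?_⟩
    · have := hal i hi; omega
    · refine Nat.pow_lt_pow_right (by omega) ?_
      have := hmN j₀ hj₀
      simp only [ha]; omega
  have hw0 : 0 < ((D : ℤ) - 1) * (D : ℤ) ^ (N - (k + r)) :=
    mul_pos (by linarith) (by positivity)
  have hsub : ∑ i ∈ s, ((D : ℤ) ^ (N - a i) - (D : ℤ) ^ (N - l i)) =
      ((∑ i ∈ s, D ^ (N - a i) : ℕ) : ℤ) - ((∑ i ∈ s, D ^ (N - l i) : ℕ) : ℤ) := by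
    rw [Finset.sum_sub_distrib]; push_cast; rfl
  rw [hsub] at hq
  have hq0 : 0 < q := by
    refine pos_of_mul_pos_right ?_ hw0.le
    rw [← hq]; omega
  obtain ⟨q', rfl⟩ : ∃ q' : ℕ, q = q' + 1 := ⟨(q - 1).toNat, by omega⟩
  have hwc : (((D - 1) * D ^ (N - (k + r)) : ℕ) : ℤ) = ((D : ℤ) - 1) * (D : ℤ) ^ (N - (k + r)) := by
    push_cast [Nat.cast_sub (show 1 ≤ D by omega)]; rfl
  have hX : D ^ N + (D - 1) * D ^ (N - (k + r)) + q' * ((D - 1) * D ^ (N - (k + r))) =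
      ∑ i ∈ s, D ^ (N - a i) := by
    rw [hlsum] at hq
    zify
    rw [← hwc] at hq
    push_cast at hq ⊢
    linarith
  have hupd := sum_comp_update hj₀ (fun _ x => D ^ (N - x)) l (l j₀ - 1)
  have hp := pow_sub_succ_eq hD (show 0 < l j₀ by omega) (hlN j₀ hj₀)
  have hval : ∀ j, Function.update l j₀ (l j₀ - 1) j = if j = j₀ then l j₀ - 1 else l j :=
    fun j => Function.update_apply ..
  have haj₀ : a j₀ < l j₀ := by
    have := hmN j₀ hj₀
    simp only [ha]; omega
  have hwle : (D - 1) * D ^ (N - l j₀) ≤ (D - 1) * D ^ (N - (k + r)) :=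
    Nat.mul_le_mul_left _ (Nat.pow_le_pow_right (by omega) (by omega))
  obtain ⟨c, hc, hcsum⟩ := exists_between_sum_pow_eq hD s a hkN.le hX
    (Function.update l j₀ (l j₀ - 1))
    (fun j hj => by
      have := hal j hj
      rw [hval]; split_ifs with h
      · subst h; omega
      · exact this)
    (fun j hj => by
      have := hlN j hj
      rw [hval]; split_ifs <;> omega)
    (fun j hj => by
      rw [hval]; simp only [ha]; split_ifs with h
      · subst h; omega
      · omega)
    (by rw [hs] at *; omega)
  have hcl : ∀ i ∈ s, c i ≤ l i := fun i hi => by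
    have := (hc i hi).2
    rw [hval] at this; split_ifs at this with h
    · subst h; omega
    · exact this
  refine ⟨c, fun i hi => ⟨(hc i hi).1, hcl i hi⟩, ?_, ?_⟩
  · have := (hc j₀ hj₀).2
    rw [Function.update_self] at this
    omega
  · have h1 := kraft_mul_pow hD (l := c) (T := N) fun i hi => (hcl i hi).trans (hlN i hi)
    rw [← hs, hcsum] at h1
    have hD0 : (D : ℝ) ≠ 0 := by positivity
    have hDN : (D : ℝ) ^ N ≠ 0 := by positivity
    apply mul_right_cancel₀ hDN
    rw [h1]
    push_cast [Nat.cast_sub (show 1 ≤ D by omega)]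
    rw [pow_sub₀ _ hD0 hkN.le, inv_pow]
    ring

/-- For the linear penalty, with L = ⌈(n−1)/(D−1)⌉ the trivial maximum
length and l_ub an integer with l_min < l_ub < L and n ≤ D^{l_ub}: if a length vector
minimizing Σ p_i·l_i among feasible length vectors with entries in [l_min, L] has some
entry strictly greater than l_ub, then there exists a length vector minimizing
Σ p_i·l_i among feasible length vectors with entries in [l_min, l_ub] whose maximum
entry equals l_ub. -/
theorem statement7 (D lmin n : ℕ) (hD : 2 ≤ D) (hlmin : 0 ≤ lmin)
    (hn1 : D ^ lmin < n) (hmod : (D - 1) ∣ (n - 1))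
    (p : ℕ → ℝ) (hppos : ∀ i ∈ Finset.Icc 1 n, 0 < p i)
    (hpdec : ∀ i ∈ Finset.Icc 1 n, ∀ j ∈ Finset.Icc 1 n, i ≤ j → p j ≤ p i)
    (L : ℕ) (hL : (L : ℤ) = ⌈((n : ℝ) - 1) / ((D : ℝ) - 1)⌉)
    (lub : ℕ) (hub1 : lmin < lub) (hub2 : lub < L) (hub3 : n ≤ D ^ lub)
    (l : ℕ → ℕ) (hlb : ∀ i ∈ Finset.Icc 1 n, lmin ≤ l i ∧ l i ≤ L)
    (hfeas : kraft D n l ≤ 1)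
    (hopt : ∀ l' : ℕ → ℕ, (∀ i ∈ Finset.Icc 1 n, lmin ≤ l' i ∧ l' i ≤ L) →
      kraft D n l' ≤ 1 → linPenalty n p l ≤ linPenalty n p l')
    (hbig : ∃ i ∈ Finset.Icc 1 n, lub < l i) :
    ∃ l'' : ℕ → ℕ,
      (∀ i ∈ Finset.Icc 1 n, lmin ≤ l'' i ∧ l'' i ≤ lub) ∧
      kraft D n l'' ≤ 1 ∧
      (∀ l' : ℕ → ℕ, (∀ i ∈ Finset.Icc 1 n, lmin ≤ l' i ∧ l' i ≤ lub) →
        kraft D n l' ≤ 1 → linPenalty n p l'' ≤ linPenalty n p l') ∧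
      (∃ i ∈ Finset.Icc 1 n, l'' i = lub) := by
  obtain ⟨m, hmb, hmk, hmopt⟩ := exists_optimal hD hub1.le hub3 p
  by_cases hmax : ∃ i ∈ Finset.Icc 1 n, m i = lub
  · exact ⟨m, hmb, hmk, hmopt, hmax⟩
  push Not at hmax
  have hmlt : ∀ i ∈ Finset.Icc 1 n, m i < lub := fun i hi =>
    lt_of_le_of_ne (hmb i hi).2 (hmax i hi)
  have hl1 := kraft_eq_one_of_optimal hD hn1 hmod hppos hlb hfeas hopt
  have hm1 := kraft_eq_one_of_optimal hD hn1 hmod hppos hmb hmk hmopt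
  obtain ⟨i₁, hi₁, hlub⟩ := hbig
  obtain ⟨j₀, hj₀, hlN⟩ := Finset.exists_max_image (Finset.Icc 1 n) l ⟨i₁, hi₁⟩
  have hN : lub < l j₀ := hlub.trans_le (hlN i₁ hi₁)
  obtain ⟨r, hr⟩ : ∃ r, l j₀ = lub + r := ⟨l j₀ - lub, by omega⟩
  have hD1 : (1 : ℝ) < D := by exact_mod_cast hD
  have hDpos : (0 : ℝ) < D := by linarith
  have hx0 : (0 : ℝ) < (D : ℝ)⁻¹ := inv_pos.2 hDpos
  have hx1 : (D : ℝ)⁻¹ < 1 := inv_lt_one_of_one_lt₀ hD1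
  have hDx : (D : ℝ) * (D : ℝ)⁻¹ = 1 := mul_inv_cancel₀ hDpos.ne'
  -- The entries of `m` that may be decreased and lie above `l - r`.
  have hne : ((Finset.Icc 1 n).filter fun i => lmin < m i ∧ l i < m i + r).Nonempty := by
    by_contra hcon
    rw [Finset.not_nonempty_iff_eq_empty, Finset.filter_eq_empty_iff] at hcon
    obtain ⟨i, hi, hlt⟩ := exists_lt_of_kraft_le_one hD hn1 hmk
    have : kraft D n l < kraft D n m := by
      rw [kraft_eq_sum_inv_pow, kraft_eq_sum_inv_pow]
      refine Finset.sum_lt_sum (fun j hj => ?_) ⟨i, hi, ?_⟩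
      · refine pow_le_pow_of_le_one hx0.le hx1.le ?_
        have := hcon hj
        have := hmb j hj
        have := hlb j hj
        omega
      · refine pow_lt_pow_right_of_lt_one₀ hx0 hx1 ?_
        have := hcon hi
        omega
    linarith
  obtain ⟨i₀, hi₀, hkmax⟩ := Finset.exists_max_image _ m hne
  rw [Finset.mem_filter] at hi₀
  obtain ⟨hi₀, hlmin₀, hli₀⟩ := hi₀
  have hki₀ := hmlt i₀ hi₀
  have hk : ∀ i ∈ Finset.Icc 1 n, m i₀ < m i → m i + r ≤ l i := fun i hi hlt => by
    by_contra! hcon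
    have := hkmax i (Finset.mem_filter.2 ⟨hi, by omega, hcon⟩)
    omega
  obtain ⟨c, hc, hcj₀, hcsum⟩ := exists_exchange (r := r) hD hlN
    (fun i hi => by have := hmlt i hi; omega) hl1 hm1 (by omega) hk hj₀ rfl
  have hci₀ : c i₀ = l i₀ := by
    have := hc i₀ hi₀
    omega
  have hne₀ : j₀ ≠ i₀ := by rintro rfl; omega
  set l' := Function.update c i₀ (l i₀ + 1) with hl'
  set m₁ : ℕ → ℕ := fun i => m i + (l i - c i) with hm₁
  set m' := Function.update m₁ i₀ (m i₀ - 1) with hm'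
  have hm₁i₀ : m₁ i₀ = m i₀ := by simp [hm₁, hci₀]
  have hl'b : ∀ i ∈ Finset.Icc 1 n, lmin ≤ l' i ∧ l' i ≤ L := by
    intro i hi
    have h1 := hc i hi
    have h2 := hlb i hi
    have h3 := hmb i hi
    have h4 := hlb j₀ hj₀
    rw [hl', Function.update_apply]
    split_ifs with h
    · subst h; omega
    · omega
  have hm'b : ∀ i ∈ Finset.Icc 1 n, lmin ≤ m' i ∧ m' i ≤ lub := by
    intro i hi
    have h1 := hc i hi
    have h3 := hmb i hi
    have h4 := hlN i hi
    rw [hm', Function.update_apply]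
    split_ifs with h
    · omega
    · simp only [hm₁]; omega
  have hl'k : kraft D n l' ≤ 1 := by
    have h1 := sum_comp_update hi₀ (fun _ x => ((D : ℝ)⁻¹) ^ x) c (l i₀ + 1)
    simp only [← kraft_eq_sum_inv_pow] at h1
    rw [hcsum, hci₀] at h1
    have h2 : ((D : ℝ)⁻¹) ^ l i₀ = D * ((D : ℝ)⁻¹) ^ (l i₀ + 1) := by
      rw [pow_succ, mul_left_comm, hDx, mul_one]
    have h3 : ((D : ℝ)⁻¹) ^ (m i₀ + r) ≤ ((D : ℝ)⁻¹) ^ (l i₀ + 1) :=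
      pow_le_pow_of_le_one hx0.le hx1.le (by omega)
    rw [h2] at h1
    nlinarith
  have hDr : ∀ e, ((D : ℝ)⁻¹) ^ e = (D : ℝ) ^ r * ((D : ℝ)⁻¹) ^ (e + r) := fun e => by
    rw [pow_add, mul_left_comm, ← mul_pow, hDx, one_pow, mul_one]
  have hterm : ∀ i, c i ≤ l i → ((D : ℝ)⁻¹) ^ m i - (D : ℝ) ^ r * (((D : ℝ)⁻¹) ^ c i -
      ((D : ℝ)⁻¹) ^ l i) - ((D : ℝ)⁻¹) ^ m₁ i = (D : ℝ) ^ r * (1 - ((D : ℝ)⁻¹) ^ (l i - c i)) *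
        (((D : ℝ)⁻¹) ^ (m i + r) - ((D : ℝ)⁻¹) ^ c i) := fun i hi => by
    have h1 : ((D : ℝ)⁻¹) ^ l i = ((D : ℝ)⁻¹) ^ c i * ((D : ℝ)⁻¹) ^ (l i - c i) := by
      rw [← pow_add, Nat.add_sub_cancel' hi]
    rw [show m₁ i = m i + (l i - c i) from rfl, pow_add _ (m i) (l i - c i), h1, hDr (m i)]
    ring
  have hDr0 : (0 : ℝ) < (D : ℝ) ^ r := by positivity
  have hle : ∀ i ∈ Finset.Icc 1 n, ((D : ℝ)⁻¹) ^ m₁ i ≤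
      ((D : ℝ)⁻¹) ^ m i - (D : ℝ) ^ r * (((D : ℝ)⁻¹) ^ c i - ((D : ℝ)⁻¹) ^ l i) := by
    intro i hi
    have h1 := hc i hi
    rw [← sub_nonneg, hterm i h1.2]
    rcases h1.2.lt_or_eq with hlt | heq
    · exact mul_nonneg (mul_nonneg hDr0.le (sub_nonneg.2 (pow_le_one₀ hx0.le hx1.le)))
        (sub_nonneg.2 (pow_le_pow_of_le_one hx0.le hx1.le (by omega)))
    · simp [heq]
  have hsum : ∑ i ∈ Finset.Icc 1 n, (((D : ℝ)⁻¹) ^ m i -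
      (D : ℝ) ^ r * (((D : ℝ)⁻¹) ^ c i - ((D : ℝ)⁻¹) ^ l i)) =
      1 - ((D : ℝ) - 1) * ((D : ℝ)⁻¹) ^ m i₀ := by
    rw [Finset.sum_sub_distrib, ← Finset.mul_sum, Finset.sum_sub_distrib,
      ← kraft_eq_sum_inv_pow, ← kraft_eq_sum_inv_pow, ← kraft_eq_sum_inv_pow, hm1, hl1, hcsum,
      hDr (m i₀)]
    ring
  have hm'k_eq : kraft D n m' = kraft D n m₁ + ((D : ℝ) - 1) * ((D : ℝ)⁻¹) ^ m i₀ := by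
    have h1 := sum_comp_update hi₀ (fun _ x => ((D : ℝ)⁻¹) ^ x) m₁ (m i₀ - 1)
    simp only [← kraft_eq_sum_inv_pow] at h1
    rw [hm₁i₀] at h1
    have h2 : ((D : ℝ)⁻¹) ^ (m i₀ - 1) = D * ((D : ℝ)⁻¹) ^ m i₀ := by
      obtain ⟨e, he⟩ : ∃ e, m i₀ = e + 1 := ⟨m i₀ - 1, by omega⟩
      rw [he, Nat.add_sub_cancel, pow_succ, mul_left_comm, hDx, mul_one]
    rw [h2] at h1
    linarith
  have hm'k : kraft D n m' ≤ 1 := by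
    have := Finset.sum_le_sum hle
    rw [hsum, ← kraft_eq_sum_inv_pow] at this
    linarith
  have hpen : linPenalty n p m' + linPenalty n p l' = linPenalty n p m + linPenalty n p l := by
    have h1 := linPenalty_update hi₀ p c (l i₀ + 1)
    have h2 := linPenalty_update hi₀ p m₁ (m i₀ - 1)
    have h3 : linPenalty n p m₁ + linPenalty n p c = linPenalty n p m + linPenalty n p l := by
      simp only [linPenalty, ← Finset.sum_add_distrib]
      refine Finset.sum_congr rfl fun i hi => ?_
      simp only [hm₁]
      push_cast [Nat.cast_sub (hc i hi).2]
      ring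
    rw [hm₁i₀] at h2
    rw [hci₀] at h1
    push_cast [Nat.cast_sub (show 1 ≤ m i₀ by omega)] at h1 h2
    linarith
  have hm'opt : ∀ g : ℕ → ℕ, (∀ i ∈ Finset.Icc 1 n, lmin ≤ g i ∧ g i ≤ lub) →
      kraft D n g ≤ 1 → linPenalty n p m' ≤ linPenalty n p g := fun g hg hgk => by
    have h1 := hopt l' hl'b hl'k
    have h2 := hmopt g hg hgk
    linarith
  refine ⟨m', hm'b, hm'k, hm'opt, j₀, hj₀, ?_⟩
  have hm'1 := kraft_eq_one_of_optimal hD hn1 hmod hppos hm'b hm'k hm'opt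
  rw [hm', Function.update_of_ne hne₀]
  have h1 := hc j₀ hj₀
  by_contra hcon
  have hstrict : m j₀ + r < c j₀ := by
    simp only [hm₁] at hcon
    omega
  have hlt := Finset.sum_lt_sum hle ⟨j₀, hj₀, by
    rw [← sub_pos, hterm j₀ h1.2]
    exact mul_pos (mul_pos hDr0 (sub_pos.2 (pow_lt_one₀ hx0.le hx1 (by omega))))
      (sub_pos.2 (pow_lt_pow_right_of_lt_one₀ hx0 hx1 hstrict))⟩
  rw [hsum, ← kraft_eq_sum_inv_pow] at hlt
  linarith
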